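/- arXiv:1810.05814 — 4 statements merged into one kernel-verified Lean document; each statement's English description precedes it below -/
import Mathlib

section
/- Maximal likelihood estimation maximises the likelihood function: for every non-empty multiset α on Fin n and every discrete distribution r on Fin n, ∏ i, (r i)^(α i) ≤ ∏ i, (ℓ_n(α) i)^(α i). That is, the likelihood function L_α(r) = ∏ i, (r i)^(α i) on the simplex of distributions attains its maximum at the distribution ℓ_n(α)(i) = α i / ∑ j, α j. -/
open Finset

/-- **Maximal likelihood estimation maximises the likelihood function.**
For every non-empty multiset `α` on `Fin n` and every discrete distribution `r`
on `Fin n`, `∏ i, (r i)^(α i) ≤ ∏ i, (ℓ_n(α) i)^(α i)`, where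
`ℓ_n(α)(i) = α i / ∑ j, α j`. -/
theorem mle_maximises_likelihood (n : ℕ) (α : Fin n → ℕ) (hα : ∑ i, α i ≠ 0)
    (r : Fin n → ℝ) (hr0 : ∀ i, 0 ≤ r i) (hr1 : ∑ i, r i = 1) :
    ∏ i, r i ^ α i ≤ ∏ i, ((α i : ℝ) / ∑ j, (α j : ℝ)) ^ α i := by
  set N : ℝ := ∑ j, (α j : ℝ) with hN
  have hN0 : 0 < N := by
    rw [hN]
    exact_mod_cast Nat.pos_of_ne_zero hα
  set z : Fin n → ℝ := fun i => r i / ((α i : ℝ) / N) with hz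
  have hz0 : ∀ i, 0 ≤ z i := fun i => div_nonneg (hr0 i) (by positivity)
  have hmean : (∑ i, (α i : ℝ) * z i) / N ≤ 1 := by
    rw [div_le_one hN0, ← one_mul N, ← hr1, Finset.sum_mul]
    refine Finset.sum_le_sum fun i _ => ?_
    rcases Nat.eq_zero_or_pos (α i) with h | h
    · simpa [h] using mul_nonneg (hr0 i) hN0.le
    · have : (α i : ℝ) ≠ 0 := by positivity
      simp only [hz]
      field_simp
      exact le_rfl
  have hamgm := Real.geom_mean_le_arith_mean univ (fun i => (α i : ℝ)) z
    (fun i _ => Nat.cast_nonneg _) hN0 (fun i _ => hz0 i)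
  simp only [Real.rpow_natCast] at hamgm
  have hprod : ∏ i, z i ^ α i ≤ 1 := by
    by_contra! h
    exact absurd (hamgm.trans hmean) (Real.one_lt_rpow h (inv_pos.2 hN0)).not_ge
  have hfactor : ∀ i, r i ^ α i = z i ^ α i * ((α i : ℝ) / N) ^ α i := by
    intro i
    rcases Nat.eq_zero_or_pos (α i) with h | h
    · simp [h]
    · rw [← mul_pow, div_mul_cancel₀ _ (by positivity)]
  simp_rw [hfactor, Finset.prod_mul_distrib]
  exact mul_le_of_le_one_left (Finset.prod_nonneg fun i _ => by positivity) hprod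
end

section
/- Dirichlet normalisation: for n ≥ 1 and α : Fin n → ℕ with α i ≥ 1 for all i, ∫_{x ∈ Δ°_n} ∏ i, (x i)^(α i − 1) dx = (∏ i, Γ(α i)) / Γ(∑ i, α i). Consequently the Dirichlet density d_n(α) integrates to 1 over Δ°_n, so Dir_n(α) is a probability measure. -/
open MeasureTheory Finset

noncomputable section

/-- The open simplex `Δ°_n = {x : Fin n → ℝ | (∀ i, 0 < x i) ∧ ∑ i, x i = 1}`. -/
def openSimplex (n : ℕ) : Set (Fin n → ℝ) := {x | (∀ i, 0 < x i) ∧ ∑ i, x i = 1}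

/-- The open parameter domain for `Δ°_{m+1}`: the first `m` coordinates are
positive with sum `< 1`. -/
def simplexDomain (m : ℕ) : Set (Fin m → ℝ) := {y | (∀ i, 0 < y i) ∧ ∑ i, y i < 1}

/-- Parametrize the simplex `Δ°_{m+1}`: the last coordinate is `1 - ∑` of the others. -/
def toSimplex (m : ℕ) (y : Fin m → ℝ) : Fin (m + 1) → ℝ :=
  Fin.snoc y (1 - ∑ i, y i)

/-- The `m`-dimensional Lebesgue measure on the open simplex `Δ°_{m+1}`, obtained by
pushing forward Lebesgue measure on the open parameter domain along the
parametrization in which the last coordinate is `1 - ∑` of the first `m`. -/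
def simplexMeasure (m : ℕ) : Measure (Fin (m + 1) → ℝ) :=
  Measure.map (toSimplex m) (volume.restrict (simplexDomain m))

/-- The Dirichlet density `d(α)(x) = (Γ(∑ i, α i) / ∏ i, Γ(α i)) · ∏ i, (x i)^(α i − 1)`
with natural-number hyperparameters `α`. -/
def dirDensity {X : Type*} [Fintype X] (α : X → ℕ) (x : X → ℝ) : ℝ :=
  (Real.Gamma (∑ i, (α i : ℝ)) / ∏ i, Real.Gamma (α i : ℝ)) * ∏ i, x i ^ (α i - 1)

/-- The Dirichlet distribution `Dir(α)` on `Δ°_{m+1}`, i.e. the measure with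
density `d(α)` with respect to Lebesgue measure on the simplex. -/
def Dir (m : ℕ) (α : Fin (m + 1) → ℕ) : Measure (Fin (m + 1) → ℝ) :=
  (simplexMeasure m).withDensity fun x => ENNReal.ofReal (dirDensity α x)

/-- Pushforward of a multiset along `h`: `M(h)(α)(j) = ∑_{i : h i = j} α i`. -/
def mPush {n m : ℕ} (h : Fin n → Fin m) (α : Fin n → ℕ) : Fin m → ℕ :=
  fun j => ∑ i ∈ Finset.univ.filter (fun i => h i = j), α i

/-- Pushforward of a point of the simplex along `h`: `D(h)(y)(j) = ∑_{i : h i = j} y i`. -/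
def dPush {n m : ℕ} (h : Fin n → Fin m) (y : Fin n → ℝ) : Fin m → ℝ :=
  fun j => ∑ i ∈ Finset.univ.filter (fun i => h i = j), y i

theorem integral_pow_mul_sub_pow (s : ℝ) (p q : ℕ) :
    ∫ t in (0 : ℝ)..s, t ^ p * (s - t) ^ q =
      (p.factorial : ℝ) * q.factorial / (p + q + 1).factorial * s ^ (p + q + 1) := by
  induction q generalizing p with
  | zero =>
    simp only [pow_zero, mul_one, integral_pow, Nat.factorial_zero, add_zero, Nat.factorial_succ]
    have := Nat.factorial_ne_zero p
    push_cast
    field_simp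
    simp
  | succ q ih =>
    have hderiv : ∀ t ∈ Set.uIcc 0 s,
        HasDerivAt (fun t : ℝ => t ^ (p + 1) * (s - t) ^ (q + 1))
          ((p + 1) * (t ^ p * (s - t) ^ (q + 1)) - (q + 1) * (t ^ (p + 1) * (s - t) ^ q)) t := by
      intro t _
      refine ((hasDerivAt_pow (p + 1) t).mul
        (((hasDerivAt_id t).const_sub s).pow (q + 1))).congr_deriv ?_
      simp
      ring
    have hparts := intervalIntegral.integral_eq_sub_of_hasDerivAt hderiv
      (Continuous.intervalIntegrable (by fun_prop) _ _)
    rw [intervalIntegral.integral_sub (Continuous.intervalIntegrable (by fun_prop) _ _)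
      (Continuous.intervalIntegrable (by fun_prop) _ _),
      intervalIntegral.integral_const_mul, intervalIntegral.integral_const_mul, ih (p + 1)] at hparts
    have hidx : p + 1 + q + 1 = p + (q + 1) + 1 := by ring
    rw [hidx, Nat.factorial_succ p] at hparts
    rw [Nat.factorial_succ q]
    have hp : (p : ℝ) + 1 ≠ 0 := by positivity
    apply mul_left_cancel₀ hp
    simp only [sub_self, ne_eq, Nat.add_eq_zero_iff, one_ne_zero, and_false, not_false_eq_true,
      zero_pow, mul_zero, zero_mul] at hparts
    push_cast at hparts ⊢
    linear_combination hparts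

theorem lintegral_pow_mul_sub_pow {s : ℝ} (hs : 0 < s) (p q : ℕ) :
    ∫⁻ t in Set.Ioo 0 s, ENNReal.ofReal (t ^ p * (s - t) ^ q) =
      ENNReal.ofReal
        ((p.factorial : ℝ) * q.factorial / (p + q + 1).factorial * s ^ (p + q + 1)) := by
  rw [← integral_pow_mul_sub_pow, intervalIntegral.integral_of_le hs.le,
    integral_Ioc_eq_integral_Ioo, ofReal_integral_eq_lintegral_ofReal]
  · exact (Continuous.integrableOn_Icc (by fun_prop)).mono_set Set.Ioo_subset_Icc_self
  · filter_upwards [ae_restrict_mem measurableSet_Ioo] with t ht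
    exact mul_nonneg (pow_nonneg ht.1.le _) (pow_nonneg (sub_nonneg.2 ht.2.le) _)

/-- The open corner simplex of size `s`. -/
def cornerSimplex (m : ℕ) (s : ℝ) : Set (Fin m → ℝ) := {y | (∀ i, 0 < y i) ∧ ∑ i, y i < s}

theorem measurableSet_cornerSimplex (m : ℕ) (s : ℝ) : MeasurableSet (cornerSimplex m s) := by
  have h : cornerSimplex m s = (⋂ i, {y | 0 < y i}) ∩ {y | ∑ i, y i < s} := by
    ext y; simp [cornerSimplex]
  rw [h]
  exact (MeasurableSet.iInter fun i =>
    measurableSet_lt measurable_const (measurable_pi_apply i)).inter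
    (measurableSet_lt (by fun_prop) measurable_const)

theorem lintegral_cornerSimplex {s : ℝ} (hs : 0 < s) (m : ℕ) (a : Fin m → ℕ) (b : ℕ) :
    ∫⁻ y in cornerSimplex m s, ENNReal.ofReal ((∏ i, y i ^ a i) * (s - ∑ i, y i) ^ b) =
      ENNReal.ofReal ((∏ i, ((a i).factorial : ℝ)) * b.factorial / (∑ i, a i + b + m).factorial *
        s ^ (∑ i, a i + b + m)) := by
  induction m generalizing s with
  | zero =>
    have h : cornerSimplex 0 s = Set.univ := by
      ext y; simp [cornerSimplex, hs]
    have := Nat.factorial_ne_zero b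
    rw [h, Measure.restrict_univ, volume_pi, Measure.pi_of_empty _ 0, lintegral_dirac]
    simp
    field_simp
  | succ m ih =>
    set q := ∑ i : Fin m, a i.succ + b + m with hq
    set C : ℝ := (∏ i : Fin m, ((a i.succ).factorial : ℝ)) * b.factorial / q.factorial with hC
    have hC0 : 0 ≤ C := by positivity
    have hmp := (volume_preserving_piFinSuccAbove (fun _ : Fin (m + 1) => ℝ) 0).symm
    rw [← lintegral_indicator (measurableSet_cornerSimplex _ _), ← hmp.lintegral_comp_emb
      (MeasurableEquiv.measurableEmbedding _), Measure.volume_eq_prod, lintegral_prod]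
    swap
    · refine Measurable.aemeasurable ?_
      refine Measurable.comp (Measurable.indicator ?_ (measurableSet_cornerSimplex _ _))
        (MeasurableEquiv.measurable _)
      fun_prop
    have hinner : ∀ t : ℝ, (∫⁻ z : Fin m → ℝ, (cornerSimplex (m + 1) s).indicator
        (fun y => ENNReal.ofReal ((∏ i, y i ^ a i) * (s - ∑ i, y i) ^ b))
        ((MeasurableEquiv.piFinSuccAbove (fun _ : Fin (m + 1) => ℝ) 0).symm (t, z))) =
        (Set.Ioo 0 s).indicator
          (fun t => ENNReal.ofReal C * ENNReal.ofReal (t ^ a 0 * (s - t) ^ q)) t := by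
      intro t
      by_cases ht : t ∈ Set.Ioo 0 s
      · have hst : 0 < s - t := sub_pos.2 ht.2
        have hta : 0 ≤ t ^ a 0 := pow_nonneg ht.1.le _
        rw [Set.indicator_of_mem ht, ← ENNReal.ofReal_mul hC0, mul_left_comm, ENNReal.ofReal_mul hta,
          ← ih hst, ← lintegral_const_mul _ (by fun_prop),
          ← lintegral_indicator (measurableSet_cornerSimplex _ _)]
        refine lintegral_congr fun z => ?_
        have hiff : (MeasurableEquiv.piFinSuccAbove (fun _ : Fin (m + 1) => ℝ) 0).symm (t, z) ∈
            cornerSimplex (m + 1) s ↔ z ∈ cornerSimplex m (s - t) := by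
          simp [cornerSimplex, MeasurableEquiv.piFinSuccAbove, Fin.forall_fin_succ,
            Fin.sum_univ_succ, ht.1, lt_sub_iff_add_lt']
        by_cases hz : z ∈ cornerSimplex m (s - t)
        · rw [Set.indicator_of_mem hz, Set.indicator_of_mem (hiff.2 hz), ← ENNReal.ofReal_mul hta]
          simp [MeasurableEquiv.piFinSuccAbove, Fin.prod_univ_succ, Fin.sum_univ_succ, mul_assoc,
            sub_sub]
        · rw [Set.indicator_of_notMem hz, Set.indicator_of_notMem (hiff.not.2 hz)]
      · rw [Set.indicator_of_notMem ht]
        refine (lintegral_congr fun z => Set.indicator_of_notMem (fun hmem => ht ?_) _).trans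
          lintegral_zero
        simp only [cornerSimplex, MeasurableEquiv.piFinSuccAbove, Fin.forall_fin_succ,
          Fin.sum_univ_succ, Set.mem_ofPred_eq] at hmem
        simp at hmem
        have := Finset.sum_nonneg fun i (_ : i ∈ Finset.univ) => (hmem.1.2 i).le
        exact ⟨hmem.1.1, by linarith⟩
    simp_rw [hinner]
    rw [lintegral_indicator measurableSet_Ioo, lintegral_const_mul _ (by fun_prop),
      lintegral_pow_mul_sub_pow hs, ← ENNReal.ofReal_mul hC0]
    have hidx : ∑ i, a i + b + (m + 1) = a 0 + q + 1 := by
      rw [Fin.sum_univ_succ, hq]; ring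
    rw [hidx, Fin.prod_univ_succ, hC]
    have := Nat.factorial_ne_zero q
    congr 1
    field_simp

theorem measurable_toSimplex (m : ℕ) : Measurable (toSimplex m) := by
  refine measurable_pi_lambda _ fun i => ?_
  refine Fin.lastCases ?_ (fun i => ?_) i
  · simp only [toSimplex, Fin.snoc_last]
    fun_prop
  · simp only [toSimplex, Fin.snoc_castSucc]
    fun_prop

theorem simplexDomain_eq_cornerSimplex (m : ℕ) : simplexDomain m = cornerSimplex m 1 := rfl

theorem sum_natCast_eq_pred_add {m : ℕ} {α : Fin (m + 1) → ℕ} (hα : ∀ i, 1 ≤ α i) :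
    ∑ i, α i = ∑ i : Fin m, (α i.castSucc - 1) + (α (Fin.last m) - 1) + m + 1 := by
  have h : ∑ i, α i = ∑ i, ((α i - 1) + 1) := Finset.sum_congr rfl fun i _ => by have := hα i; omega
  rw [h, Finset.sum_add_distrib, Fin.sum_univ_castSucc]
  simp
  ring

theorem Gamma_natCast_of_one_le {k : ℕ} (hk : 1 ≤ k) :
    Real.Gamma k = ((k - 1).factorial : ℝ) := by
  obtain ⟨k, rfl⟩ := Nat.exists_eq_add_of_le' hk
  simpa using Real.Gamma_nat_eq_factorial k

theorem lintegral_simplexMeasure_prod_pow (m : ℕ) (α : Fin (m + 1) → ℕ) (hα : ∀ i, 1 ≤ α i) :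
    ∫⁻ x, ENNReal.ofReal (∏ i, x i ^ (α i - 1)) ∂simplexMeasure m =
      ENNReal.ofReal ((∏ i, Real.Gamma (α i : ℝ)) / Real.Gamma (∑ i, (α i : ℝ))) := by
  rw [simplexMeasure, lintegral_map (by fun_prop) (measurable_toSimplex m)]
  simp only [Fin.prod_univ_castSucc, toSimplex, Fin.snoc_castSucc, Fin.snoc_last]
  rw [simplexDomain_eq_cornerSimplex, lintegral_cornerSimplex one_pos, ← Nat.cast_sum,
    sum_natCast_eq_pred_add hα, Nat.cast_add_one, Real.Gamma_nat_eq_factorial]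
  simp [Gamma_natCast_of_one_le, hα]

theorem ae_simplexMeasure_prod_pow_nonneg (m : ℕ) (α : Fin (m + 1) → ℕ) :
    0 ≤ᵐ[simplexMeasure m] fun x => ∏ i, x i ^ (α i - 1) := by
  refine (ae_map_iff (measurable_toSimplex m).aemeasurable
    (measurableSet_le measurable_const (by fun_prop))).2 ?_
  rw [simplexDomain_eq_cornerSimplex]
  filter_upwards [ae_restrict_mem (measurableSet_cornerSimplex m 1)] with y hy
  simp only [Fin.prod_univ_castSucc, toSimplex, Fin.snoc_castSucc, Fin.snoc_last]
  exact mul_nonneg (Finset.prod_nonneg fun i _ => pow_nonneg (hy.1 i).le _)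
    (pow_nonneg (sub_nonneg.2 hy.2.le) _)

/-- **Dirichlet normalisation.** For `n = m + 1 ≥ 1` and hyperparameters
`α : Fin n → ℕ` with `α i ≥ 1` for all `i`,
`∫_{Δ°_n} ∏ i, (x i)^(α i − 1) dx = (∏ i, Γ(α i)) / Γ(∑ i, α i)`;
consequently the Dirichlet density integrates to one, i.e. `Dir(α)` is a
probability measure. -/
theorem dirichlet_normalisation (m : ℕ) (α : Fin (m + 1) → ℕ) (hα : ∀ i, 1 ≤ α i) :
    (∫ x, (∏ i, x i ^ (α i - 1)) ∂simplexMeasure m)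
        = (∏ i, Real.Gamma (α i : ℝ)) / Real.Gamma (∑ i, (α i : ℝ)) ∧
      IsProbabilityMeasure (Dir m α) := by
  have hGamma : ∀ k : ℕ, 1 ≤ k → 0 < Real.Gamma k := fun k hk =>
    Real.Gamma_pos_of_pos (by exact_mod_cast hk)
  have hprod : 0 < ∏ i, Real.Gamma (α i : ℝ) := Finset.prod_pos fun i _ => hGamma _ (hα i)
  have hsum : 0 < Real.Gamma (∑ i, (α i : ℝ)) := by
    rw [← Nat.cast_sum]
    exact hGamma _ ((hα 0).trans (Finset.single_le_sum (fun _ _ => Nat.zero_le _) (mem_univ 0)))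
  have hlint := lintegral_simplexMeasure_prod_pow m α hα
  refine ⟨?_, ⟨?_⟩⟩
  · rw [integral_eq_lintegral_of_nonneg_ae (ae_simplexMeasure_prod_pow_nonneg m α)
      (Measurable.aestronglyMeasurable (by fun_prop)), hlint, ENNReal.toReal_ofReal (by positivity)]
  · rw [Dir, withDensity_apply _ MeasurableSet.univ, Measure.restrict_univ]
    simp only [dirDensity]
    simp_rw [ENNReal.ofReal_mul (div_pos hsum hprod).le]
    rw [lintegral_const_mul _ (by fun_prop), hlint, ← ENNReal.ofReal_mul (by positivity),
      div_mul_div_cancel₀ hprod.ne', div_self hsum.ne', ENNReal.ofReal_one]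
end
end

section
/- Conjugate-prior update of the Dirichlet distribution: let α : Fin n → ℕ with α j ≥ 1 for all j, fix i : Fin n, and let α + e_i denote α with the i-th hyperparameter incremented by one. Then the Dirichlet distribution updated (conditioned) by the lifted point predicate x ↦ x i equals Dir_n(α + e_i); explicitly, for every measurable subset M ⊆ Δ°_n, ∫_M d_n(α + e_i)(x) dx = (∫_M (x i) · d_n(α)(x) dx) / (α i / ∑ j, α j). -/
open MeasureTheory Finset

noncomputable section

/-- Incrementing the `i`-th hyperparameter multiplies the Dirichlet density by `x i`,
up to the normalizing factor `α i / ∑ j, α j`. -/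
theorem dirDensity_update_succ {X : Type*} [Fintype X] [DecidableEq X] (α : X → ℕ) (i : X)
    (hα : 1 ≤ α i) (x : X → ℝ) :
    dirDensity (Function.update α i (α i + 1)) x
      = x i * dirDensity α x / ((α i : ℝ) / ∑ j, (α j : ℝ)) := by
  have hαi : (α i : ℝ) ≠ 0 := by exact_mod_cast Nat.one_le_iff_ne_zero.mp hα
  have hsum : ∑ j, (α j : ℝ) ≠ 0 := by
    exact_mod_cast Nat.one_le_iff_ne_zero.mp
      (hα.trans (Finset.single_le_sum (fun _ _ => Nat.zero_le _) (Finset.mem_univ i)))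
  have hrest : ∀ j ∈ ({i}ᶜ : Finset X), Function.update α i (α i + 1) j = α j := by
    intro j hj
    rw [Function.update_of_ne (by simpa using hj)]
  have hS : ∑ j, (Function.update α i (α i + 1) j : ℝ) = ∑ j, (α j : ℝ) + 1 := by
    rw [Fintype.sum_eq_add_sum_compl i, Fintype.sum_eq_add_sum_compl i (fun j => (α j : ℝ)),
      Finset.sum_congr rfl fun j hj => by rw [hrest j hj]]
    simp only [Function.update_self]
    push_cast
    ring
  have hG : ∏ j, Real.Gamma (Function.update α i (α i + 1) j : ℝ)
      = α i * ∏ j, Real.Gamma (α j : ℝ) := by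
    rw [Fintype.prod_eq_mul_prod_compl i,
      Fintype.prod_eq_mul_prod_compl i (fun j => Real.Gamma (α j : ℝ)),
      Finset.prod_congr rfl fun j hj => by rw [hrest j hj]]
    simp only [Function.update_self]
    rw [Nat.cast_succ, Real.Gamma_add_one hαi, mul_assoc]
  have hP : ∏ j, x j ^ (Function.update α i (α i + 1) j - 1) = x i * ∏ j, x j ^ (α j - 1) := by
    rw [Fintype.prod_eq_mul_prod_compl i,
      Fintype.prod_eq_mul_prod_compl i (fun j => x j ^ (α j - 1)),
      Finset.prod_congr rfl fun j hj => by rw [hrest j hj]]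
    simp only [Function.update_self]
    rw [← mul_assoc, ← pow_succ', Nat.sub_add_cancel hα, Nat.add_sub_cancel]
  rw [dirDensity, dirDensity, hS, hG, hP, Real.Gamma_add_one hsum]
  simp only [div_eq_mul_inv, mul_inv, inv_inv]
  ring

/-- **Conjugate-prior update of the Dirichlet distribution.** Let `α : Fin n → ℕ`
(with `n = m + 1 ≥ 1`) satisfy `α j ≥ 1` for all `j`, and fix `i`. The Dirichlet
distribution updated (conditioned) by the lifted point predicate `x ↦ x i` is
`Dir(α + e_i)`: for every measurable `M ⊆ Δ°_n`,
`∫_M d(α + e_i)(x) dx = (∫_M (x i) · d(α)(x) dx) / (α i / ∑ j, α j)`,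
where `α i / ∑ j, α j` is the validity `Dir(α) ⊨ (x ↦ x i)`. -/
theorem dirichlet_conjugate_update (m : ℕ) (α : Fin (m + 1) → ℕ)
    (hα : ∀ j, 1 ≤ α j) (i : Fin (m + 1)) (M : Set (Fin (m + 1) → ℝ))
    (hM : MeasurableSet M) (hMs : M ⊆ openSimplex (m + 1)) :
    ∫ x in M, dirDensity (Function.update α i (α i + 1)) x ∂simplexMeasure m
      = (∫ x in M, x i * dirDensity α x ∂simplexMeasure m)
          / ((α i : ℝ) / ∑ j, (α j : ℝ)) := by
  simp_rw [dirDensity_update_succ α i (hα i), integral_div]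
end
end

section
/- Second factorisation of the 6-dimensional Dirichlet density with shifted marginal hyperparameters: let α : Fin 2 × Fin 3 → ℕ with α(i,j) ≥ 1 for all i,j and β_i = ∑_j α(i,j) ≥ 3. For x ∈ Δ°_6 regarded as x : Fin 2 × Fin 3 → ℝ with y_i = ∑_j x(i,j), d_6(α)(x) = [((β₁+β₂−1)(β₁+β₂−2)(β₁+β₂−3)(β₁+β₂−4)) / ((β₁−1)(β₁−2)(β₂−1)(β₂−2))] · d_2(β₁−2, β₂−2)(y₁, y₂) · d_3(α(1,0), α(1,1), α(1,2))(x(1,·)/y₁) · d_3(α(2,0), α(2,1), α(2,2))(x(2,·)/y₂). -/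
open MeasureTheory Finset

noncomputable section

theorem Real.Gamma_eq_mul_Gamma_sub_two {s : ℝ} (h₁ : s ≠ 1) (h₂ : s ≠ 2) :
    Real.Gamma s = (s - 1) * (s - 2) * Real.Gamma (s - 2) := by
  have e₁ := Real.Gamma_add_one (sub_ne_zero.mpr h₁)
  have e₂ := Real.Gamma_add_one (sub_ne_zero.mpr h₂)
  rw [sub_add_cancel] at e₁
  rw [show s - 2 + 1 = s - 1 by ring] at e₂
  rw [e₁, e₂, mul_assoc]

/-- Normalising the arguments of a monomial by `y` costs a power of `y`. -/
theorem prod_pow_sub_one_eq_pow_mul_prod_div {ι : Type*} [Fintype ι] {α : ι → ℕ}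
    (hα : ∀ i, 1 ≤ α i) (x : ι → ℝ) {y : ℝ} (hy : y ≠ 0) :
    ∏ i, x i ^ (α i - 1)
      = y ^ (∑ i, α i - Fintype.card ι) * ∏ i, (x i / y) ^ (α i - 1) := by
  have hsum : ∑ i, α i - Fintype.card ι = ∑ i, (α i - 1) := by
    rw [Finset.sum_tsub_distrib _ fun i _ => hα i]
    simp
  rw [hsum, ← Finset.prod_pow_eq_pow_sum, ← Finset.prod_mul_distrib]
  refine Finset.prod_congr rfl fun i _ => ?_
  rw [← mul_pow, mul_div_cancel₀ _ hy]

theorem dirichlet_normalisation_cancel {b₀ b₁ g₀ g₁ c₀ c₁ : ℝ} (hb₀ : 3 ≤ b₀) (hb₁ : 3 ≤ b₁)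
    (h₀ : g₀ ≠ 0) (h₁ : g₁ ≠ 0) (hc₀ : c₀ ≠ 0) (hc₁ : c₁ ≠ 0) (n g p₀ p₁ q₀ q₁ : ℝ) :
    n * g / (g₀ * g₁) * (q₀ * p₀ * (q₁ * p₁)) =
      n / ((b₀ - 1) * (b₀ - 2) * ((b₁ - 1) * (b₁ - 2))) * (g / (c₀ * c₁) * (q₀ * q₁)) *
        ((b₀ - 1) * (b₀ - 2) * c₀ / g₀ * p₀) * ((b₁ - 1) * (b₁ - 2) * c₁ / g₁ * p₁) := by
  have : b₀ - 1 ≠ 0 := by grind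
  have : b₀ - 2 ≠ 0 := by grind
  have : b₁ - 1 ≠ 0 := by grind
  have : b₁ - 2 ≠ 0 := by grind
  field_simp

/-- **Second factorisation of the 6-dimensional Dirichlet density with shifted
marginal hyperparameters.** Let `α : Fin 2 × Fin 3 → ℕ` with all entries `≥ 1`
and row sums `β_i = ∑_j α(i,j) ≥ 3`; let `x` range over the open simplex of
`Fin 2 × Fin 3` with `y_i = ∑_j x(i,j)`. Then
`d_6(α)(x) = [((β₁+β₂−1)(β₁+β₂−2)(β₁+β₂−3)(β₁+β₂−4)) / ((β₁−1)(β₁−2)(β₂−1)(β₂−2))]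
· d_2(β₁−2, β₂−2)(y₁,y₂) · d_3(α(1,·))(x(1,·)/y₁) · d_3(α(2,·))(x(2,·)/y₂)`
(rows indexed by `0` and `1` here). -/
theorem dirichlet_factorisation_2x3_shifted (α : Fin 2 × Fin 3 → ℕ)
    (hα : ∀ ij, 1 ≤ α ij)
    (hβ1 : 3 ≤ ∑ j, α (0, j)) (hβ2 : 3 ≤ ∑ j, α (1, j))
    (x : Fin 2 × Fin 3 → ℝ) (hx1 : ∀ ij, 0 < x ij) (hx2 : ∑ ij, x ij = 1) :
    dirDensity α x
      = ((((∑ j, α (0, j) : ℕ) : ℝ) + ((∑ j, α (1, j) : ℕ) : ℝ) - 1)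
            * (((∑ j, α (0, j) : ℕ) : ℝ) + ((∑ j, α (1, j) : ℕ) : ℝ) - 2)
            * (((∑ j, α (0, j) : ℕ) : ℝ) + ((∑ j, α (1, j) : ℕ) : ℝ) - 3)
            * (((∑ j, α (0, j) : ℕ) : ℝ) + ((∑ j, α (1, j) : ℕ) : ℝ) - 4))
          / (((((∑ j, α (0, j) : ℕ) : ℝ) - 1) * ((((∑ j, α (0, j) : ℕ) : ℝ)) - 2))
              * ((((∑ j, α (1, j) : ℕ) : ℝ) - 1) * ((((∑ j, α (1, j) : ℕ) : ℝ)) - 2)))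
          * dirDensity (fun i : Fin 2 => (∑ j, α (i, j)) - 2)
              (fun i : Fin 2 => ∑ j, x (i, j))
          * dirDensity (fun j : Fin 3 => α (0, j))
              (fun j : Fin 3 => x (0, j) / ∑ j', x (0, j'))
          * dirDensity (fun j : Fin 3 => α (1, j))
              (fun j : Fin 3 => x (1, j) / ∑ j', x (1, j')) := by
  have hy : ∀ i, ∑ j, x (i, j) ≠ 0 := fun i =>
    (Finset.sum_pos (fun j _ => hx1 (i, j)) Finset.univ_nonempty).ne'
  have hmon := fun i => prod_pow_sub_one_eq_pow_mul_prod_div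
    (fun j => hα (i, j)) (fun j => x (i, j)) (hy i)
  have hΓ : ∀ i, ∏ j, Real.Gamma (α (i, j) : ℝ) ≠ 0 := fun i =>
    Finset.prod_ne_zero_iff.mpr fun j _ =>
      (Real.Gamma_pos_of_pos (Nat.cast_pos.mpr (hα (i, j)))).ne'
  simp only [Fintype.card_fin] at hmon
  simp only [dirDensity, Fintype.sum_prod_type, Fintype.prod_prod_type, Fin.sum_univ_two,
    Fin.prod_univ_two, hmon, ← Nat.cast_sum, Nat.sub_sub, Nat.reduceAdd]
  rw [Nat.cast_add, Nat.cast_add, Nat.cast_sub (by omega : 2 ≤ ∑ j, α (0, j)),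
    Nat.cast_sub (by omega : 2 ≤ ∑ j, α (1, j)), Nat.cast_ofNat]
  have hb₀ : (3 : ℝ) ≤ ((∑ j, α (0, j) : ℕ) : ℝ) := by exact_mod_cast hβ1
  have hb₁ : (3 : ℝ) ≤ ((∑ j, α (1, j) : ℕ) : ℝ) := by exact_mod_cast hβ2
  have h₀ := hΓ 0
  have h₁ := hΓ 1
  generalize ((∑ j, α (0, j) : ℕ) : ℝ) = b₀ at hb₀ ⊢
  generalize ((∑ j, α (1, j) : ℕ) : ℝ) = b₁ at hb₁ ⊢
  have hs : Real.Gamma (b₀ + b₁) = (b₀ + b₁ - 1) * (b₀ + b₁ - 2) * (b₀ + b₁ - 3)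
      * (b₀ + b₁ - 4) * Real.Gamma (b₀ - 2 + (b₁ - 2)) := by
    rw [Real.Gamma_eq_mul_Gamma_sub_two (s := b₀ + b₁) (by grind) (by grind),
      Real.Gamma_eq_mul_Gamma_sub_two (s := b₀ + b₁ - 2) (by grind) (by grind),
      show b₀ + b₁ - 2 - 2 = b₀ - 2 + (b₁ - 2) by ring]
    ring
  rw [hs, Real.Gamma_eq_mul_Gamma_sub_two (s := b₀) (by grind) (by grind),
    Real.Gamma_eq_mul_Gamma_sub_two (s := b₁) (by grind) (by grind)]
  have hg₀ : Real.Gamma (b₀ - 2) ≠ 0 := (Real.Gamma_pos_of_pos (by linarith)).ne'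
  have hg₁ : Real.Gamma (b₁ - 2) ≠ 0 := (Real.Gamma_pos_of_pos (by linarith)).ne'
  exact dirichlet_normalisation_cancel hb₀ hb₁ h₀ h₁ hg₀ hg₁ _ _ _ _ _ _
end
end
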